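/- arXiv:1910.11588 — 4 statements merged into one kernel-verified Lean document; each statement's English description precedes it below -/
import Mathlib

section
/- Let R be a commutative ring, a : Fin d → MvPolynomial (Fin d) R an update with induced map α, η an R-algebra automorphism of MvPolynomial (Fin d) R, and let α' be the map induced by the transformed update Tr_η(a). Then α' ∘ η̂ = η̂ ∘ α. Consequently, if c : Fin d → R is a witness for non-termination of the loop with guard S ⊆ (Fin d → R) and update a (i.e., α^[n](c) ∈ S for all n ∈ ℕ), then η̂(c) is a witness for non-termination of the loop with guard η̂ '' S and update Tr_η(a) (i.e., α'^[n](η̂(c)) ∈ η̂ '' S for all n ∈ ℕ). -/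
open MvPolynomial

/-- The transformed update `Tr_η(a) i = η⁻¹((aeval a)(η (X i)))`. -/
noncomputable def Tr {R : Type*} [CommRing R] {d : ℕ}
    (η : MvPolynomial (Fin d) R ≃ₐ[R] MvPolynomial (Fin d) R)
    (a : Fin d → MvPolynomial (Fin d) R) (i : Fin d) : MvPolynomial (Fin d) R :=
  η.symm (aeval a (η (X i)))

/-- The induced point map `η̂(c) i = eval c (η (X i))`. -/
noncomputable def hatMap {R : Type*} [CommRing R] {d : ℕ}
    (η : MvPolynomial (Fin d) R ≃ₐ[R] MvPolynomial (Fin d) R)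
    (c : Fin d → R) (i : Fin d) : R :=
  eval c (η (X i))

/-- The map on points induced by an update: `α(c) i = eval c (a i)`. -/
noncomputable def updMap {R : Type*} [CommRing R] {d : ℕ}
    (a : Fin d → MvPolynomial (Fin d) R) (c : Fin d → R) (i : Fin d) : R :=
  eval c (a i)

theorem eval_hatMap_aux {R : Type*} [CommRing R] {d : ℕ}
    (η : MvPolynomial (Fin d) R ≃ₐ[R] MvPolynomial (Fin d) R)
    (c : Fin d → R) (p : MvPolynomial (Fin d) R) :
    eval (hatMap η c) p = eval c (η p) := by
  have h : (aeval (hatMap η c) : MvPolynomial (Fin d) R →ₐ[R] R)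
      = (aeval c).comp (η : MvPolynomial (Fin d) R →ₐ[R] MvPolynomial (Fin d) R) := by
    apply MvPolynomial.algHom_ext
    intro i
    simp [hatMap, aeval_eq_eval]
  simpa [aeval_eq_eval] using DFunLike.congr_fun h p

theorem eval_updMap_aux {R : Type*} [CommRing R] {d : ℕ}
    (a : Fin d → MvPolynomial (Fin d) R)
    (c : Fin d → R) (p : MvPolynomial (Fin d) R) :
    eval c (aeval a p) = eval (updMap a c) p := by
  have h : (aeval c : MvPolynomial (Fin d) R →ₐ[R] R).comp (aeval a) = aeval (updMap a c) := by
    apply MvPolynomial.algHom_ext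
    intro i
    simp [updMap, aeval_eq_eval]
  simpa [aeval_eq_eval] using DFunLike.congr_fun h p

/-- `α' ∘ η̂ = η̂ ∘ α`, and hence `η̂` maps witnesses for non-termination of `(S, a)` to
witnesses for non-termination of the transformed loop `(η̂ '' S, Tr_η(a))`. -/
theorem Tr_witness_nontermination {R : Type*} [CommRing R] {d : ℕ} (hd : 1 ≤ d)
    (a : Fin d → MvPolynomial (Fin d) R)
    (η : MvPolynomial (Fin d) R ≃ₐ[R] MvPolynomial (Fin d) R)
    (S : Set (Fin d → R)) :
    updMap (Tr η a) ∘ hatMap η = hatMap η ∘ updMap a ∧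
    ∀ c : Fin d → R, (∀ n : ℕ, (updMap a)^[n] c ∈ S) →
      ∀ n : ℕ, (updMap (Tr η a))^[n] (hatMap η c) ∈ hatMap η '' S := by
  have key : updMap (Tr η a) ∘ hatMap η = hatMap η ∘ updMap a := by
    funext c i
    change eval (hatMap η c) (η.symm (aeval a (η (X i)))) = eval (updMap a c) (η (X i))
    rw [eval_hatMap_aux, AlgEquiv.apply_symm_apply, eval_updMap_aux]
  refine ⟨key, fun c hc n => ⟨(updMap a)^[n] c, hc n, ?_⟩⟩
  have hs : Function.Semiconj (hatMap η) (updMap a) (updMap (Tr η a)) :=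
    fun x => (congrFun key x).symm
  exact (hs.iterate_right n) c
end

section
/- Let R be a commutative ring, a : Fin d → MvPolynomial (Fin d) R an update with induced map α, and η an R-algebra automorphism of MvPolynomial (Fin d) R with α' the map induced by the transformed update Tr_η(a). If F ⊆ (Fin d → R) is update-invariant for a, i.e., α(c) ∈ F for all c ∈ F, then the image η̂ '' F is update-invariant for Tr_η(a), i.e., α'(c') ∈ η̂ '' F for all c' ∈ η̂ '' F. -/
open MvPolynomial

/-- `Tr` preserves update-invariance: if `F` is update-invariant for `a`, then
`η̂ '' F` is update-invariant for `Tr_η(a)`. -/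
theorem Tr_preserves_invariance {R : Type*} [CommRing R] {d : ℕ} (hd : 1 ≤ d)
    (a : Fin d → MvPolynomial (Fin d) R)
    (η : MvPolynomial (Fin d) R ≃ₐ[R] MvPolynomial (Fin d) R)
    (F : Set (Fin d → R)) (hF : ∀ c ∈ F, updMap a c ∈ F) :
    ∀ c' ∈ hatMap η '' F, updMap (Tr η a) c' ∈ hatMap η '' F := by
  have key : ∀ (c : Fin d → R) (b : Fin d → MvPolynomial (Fin d) R)
      (φ : MvPolynomial (Fin d) R →ₐ[R] MvPolynomial (Fin d) R)
      (_ : ∀ i, φ (X i) = b i) (p : MvPolynomial (Fin d) R),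
      eval (fun i => eval c (b i)) p = eval c (φ p) := by
    intro c b φ hφ p
    have h : (aeval (fun i => eval c (b i)) : MvPolynomial (Fin d) R →ₐ[R] R)
        = (aeval c).comp φ := by
      apply MvPolynomial.algHom_ext
      intro i
      simp [hφ, aeval_eq_eval]
    have h2 := DFunLike.congr_fun h p
    simpa [aeval_eq_eval] using h2
  rintro _ ⟨c, hc, rfl⟩
  refine ⟨updMap a c, hF c hc, ?_⟩
  funext i
  have h1 := key c a (aeval a) (fun i => aeval_X a i) (η (X i))
  have h2 := key c (fun i => η (X i)) η.toAlgHom (fun _ => rfl)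
    (η.symm (aeval a (η (X i))))
  have h3 : η.toAlgHom (η.symm (aeval a (η (X i)))) = aeval a (η (X i)) :=
    η.apply_symm_apply _
  rw [h3] at h2
  exact h1.trans h2.symm
end

section
/- Let ℓ ∈ ℕ, and for j = 1, …, ℓ let α_j ∈ MvPolynomial (Fin d) ℝ, e_j ∈ ℕ, and b_j ∈ ℝ with b_j > 0, such that the pairs (b_j, e_j) are pairwise distinct. For c : Fin d → ℝ define p_c : ℕ → ℝ by p_c(n) = Σ_{j=1}^ℓ (eval c α_j) · n^{e_j} · b_j^n. Then for every c: (1) there exists n₀ such that p_c(n) > 0 for all n > n₀ if and only if there exists j with eval c α_j > 0 and eval c α_i = 0 for every i such that (b_i, e_i) is lexicographically greater than (b_j, e_j); and (2) there exists n₀ such that p_c(n) ≥ 0 for all n > n₀ if and only if the condition in (1) holds or eval c α_j = 0 for all j. -/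
open MvPolynomial

theorem npe_term_isLittleO (e₁ e₂ : ℕ) (b₁ b₂ : ℝ) (h₁ : 0 < b₁)
    (h : b₁ < b₂ ∨ (b₁ = b₂ ∧ e₁ < e₂)) :
    (fun n : ℕ => (n : ℝ) ^ e₁ * b₁ ^ n) =o[Filter.atTop]
      (fun n : ℕ => (n : ℝ) ^ e₂ * b₂ ^ n) := by
  rcases h with h | ⟨rfl, h⟩
  · have hn : ‖b₁‖ < b₂ := by rwa [Real.norm_of_nonneg h₁.le]
    refine (isLittleO_pow_const_mul_const_pow_const_pow_of_norm_lt e₁ hn).trans_isBigO ?_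
    refine Asymptotics.IsBigO.of_bound 1 ?_
    filter_upwards [Filter.eventually_ge_atTop 1] with n hn1
    have hn2 : (1 : ℝ) ≤ (n : ℝ) ^ e₂ := one_le_pow₀ (by exact_mod_cast hn1)
    rw [norm_mul, one_mul]
    refine le_mul_of_one_le_left (norm_nonneg _) ?_
    exact hn2.trans (le_abs_self _)
  · have h2 : (fun n : ℕ => (n : ℝ) ^ e₁) =o[Filter.atTop] (fun n : ℕ => (n : ℝ) ^ e₂) :=
      (Asymptotics.isLittleO_pow_pow_atTop_of_lt (𝕜 := ℝ) h).comp_tendsto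
        tendsto_natCast_atTop_atTop
    exact h2.mul_isBigO (Asymptotics.isBigO_refl _ _)

theorem npe_pos_of_leading (ℓ : ℕ) (a : Fin ℓ → ℝ) (e : Fin ℓ → ℕ) (b : Fin ℓ → ℝ)
    (hb : ∀ j, 0 < b j) (hdist : ∀ i j, i ≠ j → (b i, e i) ≠ (b j, e j))
    (j : Fin ℓ) (hj : 0 < a j)
    (h : ∀ i, (b j < b i ∨ (b i = b j ∧ e j < e i)) → a i = 0) :
    ∀ᶠ n : ℕ in Filter.atTop, 0 < ∑ j, a j * (n : ℝ) ^ (e j) * (b j) ^ n := by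
  have hsum : (fun n : ℕ => ∑ i ∈ Finset.univ.erase j, a i * (n : ℝ) ^ (e i) * (b i) ^ n)
      =o[Filter.atTop] (fun n : ℕ => (n : ℝ) ^ (e j) * (b j) ^ n) := by
    refine Asymptotics.IsLittleO.fun_sum fun i hi => ?_
    have hij : i ≠ j := Finset.ne_of_mem_erase hi
    by_cases hc : b j < b i ∨ (b i = b j ∧ e j < e i)
    · simp [h i hc]
    · have hlt : b i < b j ∨ (b i = b j ∧ e i < e j) := by
        have hne := hdist i j hij
        rw [Ne, Prod.mk.injEq] at hne
        push Not at hc hne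
        rcases lt_or_eq_of_le hc.1 with h1 | h1
        · exact Or.inl h1
        · exact Or.inr ⟨h1, lt_of_le_of_ne (hc.2 h1) (hne h1)⟩
      simpa only [mul_assoc] using
        (npe_term_isLittleO (e i) (e j) (b i) (b j) (hb i) hlt).const_mul_left (a i)
  filter_upwards [hsum.bound (half_pos hj), Filter.eventually_ge_atTop 1] with n hn hn1
  have hn0 : (0 : ℝ) < n := by exact_mod_cast hn1
  have hp : 0 < (n : ℝ) ^ (e j) * (b j) ^ n := mul_pos (pow_pos hn0 _) (pow_pos (hb j) _)
  rw [Real.norm_of_nonneg hp.le, Real.norm_eq_abs] at hn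
  rw [← Finset.add_sum_erase _ _ (Finset.mem_univ j)]
  have h3 := (abs_le.1 hn).1
  have h4 := mul_pos hj hp
  rw [mul_assoc (a j)]
  linarith

theorem npe_exists_leading (ℓ : ℕ) (a : Fin ℓ → ℝ) (e : Fin ℓ → ℕ) (b : Fin ℓ → ℝ) :
    (∀ j, a j = 0) ∨ ∃ j, a j ≠ 0 ∧
      ∀ i, (b j < b i ∨ (b i = b j ∧ e j < e i)) → a i = 0 := by
  by_cases h0 : ∀ j, a j = 0
  · exact Or.inl h0
  right
  push Not at h0
  obtain ⟨j₀, hj₀⟩ := h0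
  obtain ⟨j, hj, hmax⟩ := Finset.exists_max_image (Finset.univ.filter fun j => a j ≠ 0)
    (fun j => toLex (b j, e j)) ⟨j₀, by simpa using hj₀⟩
  refine ⟨j, by simpa using hj, fun i hi => ?_⟩
  by_contra hne
  have := hmax i (by simpa using hne)
  refine absurd this (not_le.2 ?_)
  rw [Prod.Lex.toLex_lt_toLex]
  rcases hi with hi | ⟨h1, h2⟩
  · exact Or.inl hi
  · exact Or.inr ⟨h1.symm, h2⟩

theorem npe_ev_iff (P : ℕ → Prop) :
    (∃ n₀ : ℕ, ∀ n : ℕ, n₀ < n → P n) ↔ ∀ᶠ n : ℕ in Filter.atTop, P n := by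
  rw [Filter.eventually_atTop]
  constructor
  · rintro ⟨N, h⟩
    exact ⟨N + 1, fun n hn => h n hn⟩
  · rintro ⟨N, h⟩
    exact ⟨N, fun n hn => h n hn.le⟩

/-- Eventual positivity of a normalized poly-exponential expression with polynomial
coefficients, evaluated at a point `c`: `p_c(n) = Σ_j (eval c α_j) · n^(e_j) · b_j^n` is
eventually positive iff some coefficient `eval c (α j)` is positive while all coefficients
belonging to lexicographically greater pairs `(b_i, e_i)` vanish; and it is eventually
non-negative iff that condition holds or all coefficients vanish. -/
theorem npe_eventually_positive_iff {d : ℕ} (hd : 1 ≤ d) (ℓ : ℕ)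
    (A : Fin ℓ → MvPolynomial (Fin d) ℝ) (e : Fin ℓ → ℕ) (b : Fin ℓ → ℝ)
    (hb : ∀ j, 0 < b j)
    (hdist : ∀ i j, i ≠ j → (b i, e i) ≠ (b j, e j))
    (c : Fin d → ℝ) :
    ((∃ n₀ : ℕ, ∀ n : ℕ, n₀ < n →
        0 < ∑ j, eval c (A j) * (n : ℝ) ^ (e j) * (b j) ^ n) ↔
      ∃ j, 0 < eval c (A j) ∧
        ∀ i, (b j < b i ∨ (b i = b j ∧ e j < e i)) → eval c (A i) = 0) ∧
    ((∃ n₀ : ℕ, ∀ n : ℕ, n₀ < n →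
        0 ≤ ∑ j, eval c (A j) * (n : ℝ) ^ (e j) * (b j) ^ n) ↔
      ((∃ j, 0 < eval c (A j) ∧
        ∀ i, (b j < b i ∨ (b i = b j ∧ e j < e i)) → eval c (A i) = 0) ∨
        ∀ j, eval c (A j) = 0)) := by
  rw [npe_ev_iff, npe_ev_iff]
  have hpos := fun j h1 h2 => npe_pos_of_leading ℓ (fun j => eval c (A j)) e b hb hdist j h1 h2
  have key : (∀ᶠ n : ℕ in Filter.atTop,
        0 ≤ ∑ j, eval c (A j) * (n : ℝ) ^ (e j) * (b j) ^ n) →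
      ((∃ j, 0 < eval c (A j) ∧
        ∀ i, (b j < b i ∨ (b i = b j ∧ e j < e i)) → eval c (A i) = 0) ∨
        ∀ j, eval c (A j) = 0) := by
    intro h
    rcases npe_exists_leading ℓ (fun j => eval c (A j)) e b with h0 | ⟨j, hj, hl⟩
    · exact Or.inr h0
    · left
      refine ⟨j, ?_, hl⟩
      by_contra hn
      have hneg : eval c (A j) < 0 := lt_of_le_of_ne (not_lt.1 hn) hj
      have hp := npe_pos_of_leading ℓ (fun j => -eval c (A j)) e b hb hdist j
        (neg_pos.2 hneg) (fun i hi => neg_eq_zero.2 (hl i hi))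
      obtain ⟨n, h1, h2⟩ := (h.and hp).exists
      simp only [neg_mul, Finset.sum_neg_distrib] at h2
      linarith
  refine ⟨⟨fun h => ?_, fun ⟨j, h1, h2⟩ => hpos j h1 h2⟩, ⟨key, ?_⟩⟩
  · rcases key (h.mono fun n hn => hn.le) with h1 | h0
    · exact h1
    · obtain ⟨n, hn⟩ := h.exists
      simp [h0] at hn
  · rintro (⟨j, h1, h2⟩ | h0)
    · exact (hpos j h1 h2).mono fun n hn => hn.le
    · exact Filter.Eventually.of_forall fun n => by simp [h0]
end

section
/- Let K be a field, d ≥ 1, and let η be a K-algebra automorphism of MvPolynomial (Fin d) K. Let δ = max over i : Fin d of the total degree of η(X i). Then for every i : Fin d, the total degree of η⁻¹(X i) is at most δ^(d−1). -/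
open MvPolynomial

theorem aux_finrank (K : Type*) [Field K] (m N : ℕ) :
    Module.finrank K (restrictTotalDegree (Fin m) K N) = (N + m).choose m := by
  have h1 := Module.finrank_eq_nat_card_basis
    (basisRestrictSupport K {n : Fin m →₀ ℕ | (n.sum fun _ e => e) ≤ N})
  have h2 : {n : Fin m →₀ ℕ | (n.sum fun _ e => e) ≤ N} =
      (((Finset.range (N + 1)).biUnion fun k =>
        (Finset.univ : Finset (Fin m)).finsuppAntidiag k : Finset (Fin m →₀ ℕ)) :
          Set (Fin m →₀ ℕ)) := by
    ext s
    simp [Finset.mem_finsuppAntidiag, Finsupp.sum_fintype]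
  have h3 : Module.finrank K (restrictTotalDegree (Fin m) K N) =
      Nat.card {n : Fin m →₀ ℕ | (n.sum fun _ e => e) ≤ N} := h1
  rw [h3, h2, Nat.card_coe_set_eq, Set.ncard_coe_finset, Finset.card_biUnion]
  · simp only [Finset.card_finsuppAntidiag_nat_eq_multichoose, Finset.card_univ,
      Fintype.card_fin]
    exact Nat.sum_range_multichoose N m
  · intro a _ b _ hab
    rw [Function.onFun, Finset.disjoint_left]
    intro s hs ht
    rw [Finset.mem_finsuppAntidiag] at hs ht
    exact hab (hs.1.symm.trans ht.1)

theorem aux_choose (e k m : ℕ) :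
    (k + m + 1).choose (m + 1) + e * (k + m).choose m ≤ (k + e + m + 1).choose (m + 1) := by
  induction e with
  | zero => simp
  | succ e ih =>
    have h : (k + m).choose m ≤ (k + e + m + 1).choose m :=
      Nat.choose_le_choose m (by omega)
    have h2 := Nat.choose_succ_succ (k + e + m + 1) m
    have h3 : k + (e + 1) + m + 1 = (k + e + m + 1).succ := by omega
    rw [h3, h2]
    linarith

theorem aux_limit (e c δ m : ℕ)
    (h : ∀ k : ℕ, e * (k + m).choose m ≤ (k * δ + c).choose m) : e ≤ δ ^ m := by
  have h1 : ∀ k : ℕ, (e : ℝ) ≤ (((k : ℝ) * δ + c) / (k + 1)) ^ m := by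
    intro k
    have a1 := Nat.pow_le_choose (α := ℝ) m (k + m)
    have a2 := Nat.choose_le_pow_div (α := ℝ) m (k * δ + c)
    have a3 : (e : ℝ) * ((k + m).choose m : ℝ) ≤ ((k * δ + c).choose m : ℝ) := by
      exact_mod_cast h k
    have a4 : k + m + 1 - m = k + 1 := by omega
    rw [a4] at a1
    push_cast at a1 a2
    have f : (0 : ℝ) < (m.factorial : ℝ) := by exact_mod_cast m.factorial_pos
    have a5 : (e : ℝ) * (((k : ℝ) + 1) ^ m / m.factorial) ≤
        ((k : ℝ) * δ + c) ^ m / m.factorial :=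
      (mul_le_mul_of_nonneg_left a1 (Nat.cast_nonneg e)).trans (a3.trans a2)
    rw [← mul_div_assoc, div_le_div_iff_of_pos_right f] at a5
    rw [div_pow, le_div_iff₀ (by positivity)]
    exact a5
  have h2 : Filter.Tendsto (fun k : ℕ => (((k : ℝ) * δ + c) / (k + 1)) ^ m) Filter.atTop
      (nhds ((δ : ℝ) ^ m)) := by
    apply Filter.Tendsto.pow
    have t := (tendsto_one_div_add_atTop_nhds_zero_nat (𝕜 := ℝ)).const_mul ((c : ℝ) - δ)
    have t2 := t.const_add (δ : ℝ)
    simp only [mul_zero, add_zero] at t2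
    refine t2.congr fun k => ?_
    have : (k : ℝ) + 1 ≠ 0 := by positivity
    field_simp
    ring
  have h3 := ge_of_tendsto' h2 h1
  exact_mod_cast h3

theorem aux_totalDegree_aeval {K : Type*} [Field K] {σ τ : Type*}
    (f : σ → MvPolynomial τ K) (D : ℕ) (hf : ∀ i, (f i).totalDegree ≤ D)
    (p : MvPolynomial σ K) : (aeval f p).totalDegree ≤ p.totalDegree * D := by
  classical
  rw [aeval_def, eval₂_eq]
  refine totalDegree_finsetSum_le fun s hs => ?_
  refine (totalDegree_mul _ _).trans ?_
  have h0 : (algebraMap K (MvPolynomial τ K) (coeff s p)).totalDegree = 0 :=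
    totalDegree_C _
  rw [h0, zero_add]
  refine (totalDegree_finsetProd _ _).trans ?_
  have h1 : ∑ i ∈ s.support, (f i ^ s i).totalDegree ≤ ∑ i ∈ s.support, s i * D :=
    Finset.sum_le_sum fun i _ =>
      (totalDegree_pow _ _).trans (Nat.mul_le_mul_left _ (hf i))
  refine h1.trans ?_
  rw [← Finset.sum_mul]
  exact Nat.mul_le_mul_right _ (le_totalDegree hs)

noncomputable def auxRes (K : Type*) [Field K] (m : ℕ) (i : Fin (m + 1)) :
    MvPolynomial (Fin (m + 1)) K →ₐ[K] MvPolynomial (Fin m) K :=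
  aeval (i.insertNth (α := fun _ => MvPolynomial (Fin m) K) 0 X)

theorem aux_ker (K : Type*) [Field K] (m : ℕ) (i : Fin (m + 1))
    (p : MvPolynomial (Fin (m + 1)) K) (hp : auxRes K m i p = 0) : X i ∣ p := by
  have key : ∀ q : MvPolynomial (Fin (m + 1)) K,
      X i ∣ q - rename i.succAbove (auxRes K m i q) := by
    intro q
    induction q using MvPolynomial.induction_on with
    | C a => simp [auxRes, algHom_C]
    | add p q hp hq =>
      have := dvd_add hp hq
      rw [map_add, map_add]
      convert this using 1
      ring
    | mul_X p j hp =>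
      rw [map_mul, map_mul]
      rcases Fin.eq_self_or_eq_succAbove i j with rfl | ⟨j, rfl⟩
      · simp [auxRes]
      · have : rename i.succAbove (auxRes K m i (X (i.succAbove j))) =
            (X (i.succAbove j) : MvPolynomial (Fin (m + 1)) K) := by
          simp [auxRes]
        rw [this, ← sub_mul]
        exact dvd_mul_of_dvd_left hp _
  have := key p
  simpa [hp] using this

theorem aux_dim {K : Type*} [Field K] {m : ℕ}
    (η : MvPolynomial (Fin (m + 1)) K ≃ₐ[K] MvPolynomial (Fin (m + 1)) K)
    (i : Fin (m + 1)) (δ : ℕ) (hδ : ∀ j, (η (X j)).totalDegree ≤ δ) (k : ℕ) :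
    (k + (η.symm (X i)).totalDegree + (m + 1)).choose (m + 1) ≤
      ((k + (η.symm (X i)).totalDegree) * δ + m).choose m + (k + (m + 1)).choose (m + 1) := by
  set G := η.symm (X i) with hG
  have hG0 : G ≠ 0 := by
    intro h
    rw [hG, map_eq_zero_iff _ η.symm.injective] at h
    exact X_ne_zero i h
  set n := k + G.totalDegree with hn
  let V := restrictTotalDegree (Fin (m + 1)) K n
  let φ : MvPolynomial (Fin (m + 1)) K →ₗ[K] MvPolynomial (Fin m) K :=
    ((auxRes K m i).comp (η : MvPolynomial (Fin (m + 1)) K →ₐ[K] _)).toLinearMap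
  let L : V →ₗ[K] MvPolynomial (Fin m) K := φ.domRestrict V
  have hres : ∀ p, (auxRes K m i p).totalDegree ≤ p.totalDegree := by
    intro p
    have := aux_totalDegree_aeval
      (i.insertNth (α := fun _ => MvPolynomial (Fin m) K) 0 X) 1 (by
        intro j
        rcases Fin.eq_self_or_eq_succAbove i j with rfl | ⟨j, rfl⟩
        · simp
        · simp) p
    simpa [auxRes] using this
  have hη : ∀ p, (η p).totalDegree ≤ p.totalDegree * δ := by
    intro p
    have h1 := aux_totalDegree_aeval (fun j => η (X j)) δ hδ p
    have h2 : aeval (fun j => η (X j)) =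
        (η : MvPolynomial (Fin (m + 1)) K →ₐ[K] MvPolynomial (Fin (m + 1)) K) := by
      ext j
      simp
    rw [h2] at h1
    exact h1
  have hrange : LinearMap.range L ≤ restrictTotalDegree (Fin m) K (n * δ) := by
    rintro _ ⟨⟨p, hp⟩, rfl⟩
    rw [mem_restrictTotalDegree] at hp ⊢
    exact (hres _).trans ((hη p).trans (Nat.mul_le_mul_right _ hp))
  have hker : (LinearMap.ker L).map V.subtype ≤
      (restrictTotalDegree (Fin (m + 1)) K k).map (LinearMap.mulLeft K G) := by
    rintro _ ⟨⟨p, hp⟩, hk, rfl⟩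
    have hk' : auxRes K m i (η p) = 0 := hk
    obtain ⟨q, hq⟩ := aux_ker K m i _ hk'
    have hpq : p = G * η.symm q := by
      rw [hG, ← map_mul, ← hq, AlgEquiv.symm_apply_apply]
    refine ⟨η.symm q, ?_, hpq.symm⟩
    rw [SetLike.mem_coe, mem_restrictTotalDegree]
    by_cases h0 : η.symm q = 0
    · simp [h0]
    · rw [mem_restrictTotalDegree, hpq, totalDegree_mul_of_isDomain hG0 h0] at hp
      omega
  have r1 := LinearMap.finrank_range_add_finrank_ker L
  have r2 := Submodule.finrank_mono hrange
  have r3 := Submodule.finrank_mono hker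
  have r4 := Submodule.finrank_map_le (LinearMap.mulLeft K G)
    (restrictTotalDegree (Fin (m + 1)) K k)
  have r5 := Submodule.finrank_map_subtype_eq V (LinearMap.ker L)
  rw [aux_finrank] at r1 r2 r4
  omega

/-- Degree bound for the inverse of a polynomial automorphism: if `η` is a `K`-algebra
automorphism of `K[x₁,…,x_d]` of degree `δ = max_i totalDegree (η (X i))`, then
`deg(η⁻¹) ≤ δ^(d−1)`, i.e., every `η⁻¹ (X i)` has total degree at most `δ^(d−1)`. -/
theorem inverse_automorphism_degree_bound {K : Type*} [Field K] {d : ℕ} (hd : 1 ≤ d)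
    (η : MvPolynomial (Fin d) K ≃ₐ[K] MvPolynomial (Fin d) K) :
    ∀ i : Fin d, (η.symm (X i)).totalDegree ≤
      (Finset.univ.sup fun j : Fin d => (η (X j)).totalDegree) ^ (d - 1) := by
  intro i
  obtain ⟨m, rfl⟩ : ∃ m, d = m + 1 := ⟨d - 1, by omega⟩
  set δ := Finset.univ.sup fun j : Fin (m + 1) => (η (X j)).totalDegree with hδ
  have hle : ∀ j, (η (X j)).totalDegree ≤ δ := fun j =>
    Finset.le_sup (f := fun j : Fin (m + 1) => (η (X j)).totalDegree) (Finset.mem_univ j)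
  rw [Nat.add_sub_cancel]
  set e := (η.symm (X i)).totalDegree with he
  refine aux_limit e (e * δ + m) δ m fun k => ?_
  have h1 := aux_dim η i δ hle k
  have h2 := aux_choose e k m
  rw [← he] at h1
  have h3 : (k + e) * δ + m = k * δ + (e * δ + m) := by ring
  rw [h3, ← add_assoc (k + e) m 1, ← add_assoc k m 1] at h1
  omega
end
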